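/- arXiv:1502.03736 — 2 statements merged into one kernel-verified Lean document; each statement's English description precedes it below -/
import Mathlib

section
/- Fix integers n ≥ 1 and 1 ≤ k ≤ n, a real number c ∈ [0, k], and a real number ε > 0. Then for all sufficiently large prime powers q (with the threshold depending on n, k, c and ε), the following holds: for every finite field F with q elements and every homogeneous ideal I ⊆ F[x₁,…,xₙ] with N := dim_F F[x₁,…,xₙ]/I finite, if dim_F F[x₁,…,xₙ]/(I + I_V) ≥ q^c / k! for every k-dimensional F-linear subspace V of Fⁿ, then N ≥ (1 − ε) · q^{cn/k} / n!. -/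
open MvPolynomial

/-- An ideal of the polynomial ring is homogeneous (with respect to the standard
grading) if it contains all homogeneous components of each of its elements. -/
def IsHomogeneousIdeal {F : Type} [Field F] {n : ℕ}
    (I : Ideal (MvPolynomial (Fin n) F)) : Prop :=
  ∀ f ∈ I, ∀ d : ℕ, MvPolynomial.homogeneousComponent d f ∈ I

/-- The ideal of a linear subspace `V ⊆ Fⁿ` through the origin: generated by the
linear forms vanishing on `V`. -/
noncomputable def linearSubspaceIdeal (F : Type) [Field F] (n : ℕ)
    (V : Submodule F (Fin n → F)) : Ideal (MvPolynomial (Fin n) F) :=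
  Ideal.span {f : MvPolynomial (Fin n) F |
    f.IsHomogeneous 1 ∧ ∀ x ∈ V, MvPolynomial.eval x f = 0}

section Slices

variable {F : Type} [Field F]

/-- The dimension of the image under `π` of the multiples `p * f`, with `f` homogeneous of
degree `e`. -/
noncomputable def sliceRank {σ A : Type} [AddCommGroup A] [Module F A]
    (π : MvPolynomial σ F →ₗ[F] A) (p : MvPolynomial σ F) (e : ℕ) : ℕ :=
  Module.finrank F ((homogeneousSubmodule σ F e).map (π ∘ₗ LinearMap.mulLeft F p))

/-- The linear form `x₀ + u₀ x₁ + ⋯ + uₘ₋₁ xₘ`. -/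
noncomputable def affineForm {m : ℕ} (u : Fin m → F) : MvPolynomial (Fin (m + 1)) F :=
  X 0 + ∑ i, C (u i) * X i.succ

/-- Restriction of polynomials to the hyperplane on which `affineForm u` vanishes. -/
noncomputable def hyperplaneRestrict {m : ℕ} (u : Fin m → F) :
    MvPolynomial (Fin (m + 1)) F →ₐ[F] MvPolynomial (Fin m) F :=
  aeval (Fin.cons (-∑ i, C (u i) * X i) X)

/-- Polynomials not involving the first variable. -/
noncomputable def liftSucc (F : Type) [Field F] (m : ℕ) :
    MvPolynomial (Fin m) F →ₐ[F] MvPolynomial (Fin (m + 1)) F :=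
  rename Fin.succ

variable {m : ℕ}

instance finite_homogeneousSubmodule {σ : Type} [Finite σ] (e : ℕ) :
    Module.Finite F (homogeneousSubmodule σ F e) :=
  Module.Finite.iff_fg.2 (homogeneousSubmodule_fg σ F e)

lemma isHomogeneous_affineForm (u : Fin m → F) : (affineForm u).IsHomogeneous 1 :=
  (isHomogeneous_X _ _).add (IsHomogeneous.sum _ _ _ fun _ _ => isHomogeneous_C_mul_X _ _)

lemma hyperplaneRestrict_liftSucc (u : Fin m → F) (f : MvPolynomial (Fin m) F) :
    hyperplaneRestrict u (liftSucc F m f) = f := by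
  have : (hyperplaneRestrict u).comp (liftSucc F m) = AlgHom.id F _ := by
    ext i
    simp [hyperplaneRestrict, liftSucc]
  exact DFunLike.congr_fun this f

lemma hyperplaneRestrict_affineForm (u : Fin m → F) :
    hyperplaneRestrict u (affineForm u) = 0 := by
  simp [hyperplaneRestrict, affineForm, ← algebraMap_eq]

lemma affineForm_dvd_sub_liftSucc (u : Fin m → F) (f : MvPolynomial (Fin (m + 1)) F) :
    affineForm u ∣ f - liftSucc F m (hyperplaneRestrict u f) := by
  rw [← Ideal.mem_span_singleton, ← Ideal.Quotient.mk_eq_mk_iff_sub_mem]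
  have : Ideal.Quotient.mkₐ F (Ideal.span {affineForm u}) =
      (Ideal.Quotient.mkₐ F (Ideal.span {affineForm u})).comp
        ((liftSucc F m).comp (hyperplaneRestrict u)) := by
    ext i
    refine Fin.cases ?_ (fun i => ?_) i
    · simp only [AlgHom.comp_apply, Ideal.Quotient.mkₐ_eq_mk]
      rw [Ideal.Quotient.mk_eq_mk_iff_sub_mem, Ideal.mem_span_singleton]
      simp [hyperplaneRestrict, liftSucc, affineForm, ← algebraMap_eq]
    · simp [hyperplaneRestrict, liftSucc]
  exact DFunLike.congr_fun this f

lemma isHomogeneous_liftSucc {f : MvPolynomial (Fin m) F} {d : ℕ} (hf : f.IsHomogeneous d) :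
    (liftSucc F m f).IsHomogeneous d :=
  hf.rename_isHomogeneous

lemma isHomogeneous_hyperplaneRestrict (u : Fin m → F) {f : MvPolynomial (Fin (m + 1)) F} {d : ℕ}
    (hf : f.IsHomogeneous d) : (hyperplaneRestrict u f).IsHomogeneous d := by
  have h : ∀ i, ((Fin.cons (-∑ i, C (u i) * X i) X : Fin (m + 1) → MvPolynomial (Fin m) F)
      i).IsHomogeneous 1 :=
    Fin.cases (IsHomogeneous.sum _ _ _ fun i _ => isHomogeneous_C_mul_X _ _).neg
      fun _ => isHomogeneous_X _ _
  simpa [hyperplaneRestrict] using hf.aeval (S := F) (n := 1) _ h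

lemma exists_isHomogeneous_of_dvd {σ : Type} {l f : MvPolynomial σ F} {e : ℕ}
    (hl : l.IsHomogeneous 1) (hf : f.IsHomogeneous (e + 1)) (h : l ∣ f) :
    ∃ g : MvPolynomial σ F, g.IsHomogeneous e ∧ f = l * g := by
  obtain ⟨g, rfl⟩ := h
  refine ⟨homogeneousComponent e g, homogeneousComponent_isHomogeneous _ _, ?_⟩
  conv_lhs => rw [← homogeneousComponent_eq_self hf]
  conv_lhs => rw [← sum_homogeneousComponent g, Finset.mul_sum, map_sum]
  have key : ∀ i, homogeneousComponent (e + 1) (l * homogeneousComponent i g) =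
      if i = e then l * homogeneousComponent e g else 0 := by
    intro i
    have hi : (l * homogeneousComponent i g).IsHomogeneous (1 + i) :=
      hl.mul (homogeneousComponent_isHomogeneous _ _)
    rw [homogeneousComponent_of_mem hi]
    split_ifs with h1 h2 h2
    · rw [h2]
    · omega
    · omega
    · rfl
  simp_rw [key]
  rw [Finset.sum_ite_eq']
  split_ifs with h
  · rfl
  · rw [homogeneousComponent_eq_zero _ _ (by simpa using h), mul_zero]

end Slices

section Averaging

variable {F : Type} [Field F]

lemma finrank_map_add_finrank_le {A B : Type} [AddCommGroup A] [Module F A] [AddCommGroup B]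
    [Module F B] (f : A →ₗ[F] B) {N M : Submodule F A} [Module.Finite F M] (hNM : N ≤ M)
    (hN : N ≤ LinearMap.ker f) :
    Module.finrank F (M.map f) + Module.finrank F N ≤ Module.finrank F M := by
  rw [← LinearMap.finrank_range_add_finrank_ker (f.domRestrict M), LinearMap.range_domRestrict]
  have h : Module.finrank F N ≤ Module.finrank F (LinearMap.ker (f.domRestrict M)) := by
    refine LinearMap.finrank_le_finrank_of_injective
      (f := (Submodule.inclusion hNM).codRestrict _ fun x => ?_) ?_
    · simpa using hN x.2
    · intro x y hxy
      exact Subtype.ext (congrArg (fun z => (z.1 : A)) hxy)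
  omega

lemma finrank_le_finrank_map_mkQ_add {A : Type} [AddCommGroup A] [Module F A]
    (M B : Submodule F A) [Module.Finite F M] [Module.Finite F B] :
    Module.finrank F M ≤ Module.finrank F (M.map B.mkQ) + Module.finrank F B := by
  rw [← LinearMap.finrank_range_add_finrank_ker (B.mkQ.domRestrict M), LinearMap.range_domRestrict]
  have h : Module.finrank F (LinearMap.ker (B.mkQ.domRestrict M)) ≤ Module.finrank F B := by
    refine LinearMap.finrank_le_finrank_of_injective
      (f := (M.subtype ∘ₗ Submodule.subtype _).codRestrict B fun x => ?_) ?_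
    · exact (Submodule.Quotient.mk_eq_zero B).1 (LinearMap.mem_ker.1 x.2)
    · intro x y hxy
      exact Subtype.ext (Subtype.ext (congrArg (fun z : B => (z : A)) hxy))
  omega

lemma sliceRank_comp_mulLeft {σ A : Type} [AddCommGroup A] [Module F A]
    (π : MvPolynomial σ F →ₗ[F] A) (p r : MvPolynomial σ F) (e : ℕ) :
    sliceRank (π ∘ₗ LinearMap.mulLeft F p) r e = sliceRank π (p * r) e := by
  rw [sliceRank, sliceRank, LinearMap.comp_assoc, LinearMap.mulLeft_mul]

/-- The map induced by `π` on polynomial functions on the hyperplane `affineForm u = 0`, with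
values modulo the image of the degree `e + 1` multiples of `affineForm u`. -/
noncomputable def restrictMap {m : ℕ} {A : Type} [AddCommGroup A] [Module F A]
    (π : MvPolynomial (Fin (m + 1)) F →ₗ[F] A) (u : Fin m → F) (e : ℕ) :
    MvPolynomial (Fin m) F →ₗ[F]
      A ⧸ (homogeneousSubmodule (Fin (m + 1)) F e).map
        (π ∘ₗ LinearMap.mulLeft F (affineForm u)) :=
  Submodule.mkQ _ ∘ₗ π ∘ₗ (liftSucc F m).toLinearMap

variable {m : ℕ} {A : Type} [AddCommGroup A] [Module F A]

lemma mkQ_eq_of_dvd (π : MvPolynomial (Fin (m + 1)) F →ₗ[F] A) (u : Fin m → F) {e : ℕ}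
    {f g : MvPolynomial (Fin (m + 1)) F} (hf : f.IsHomogeneous (e + 1))
    (hg : g.IsHomogeneous (e + 1)) (h : affineForm u ∣ f - g) :
    Submodule.mkQ ((homogeneousSubmodule (Fin (m + 1)) F e).map
        (π ∘ₗ LinearMap.mulLeft F (affineForm u))) (π f) = Submodule.mkQ _ (π g) := by
  rw [Submodule.mkQ_apply, Submodule.mkQ_apply, Submodule.Quotient.eq, ← map_sub]
  obtain ⟨k, hk, hfg⟩ := exists_isHomogeneous_of_dvd (isHomogeneous_affineForm u) (hf.sub hg) h
  exact ⟨k, hk, by simp [hfg]⟩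

lemma sliceRank_one_le_restrictMap (π : MvPolynomial (Fin (m + 1)) F →ₗ[F] A) (u : Fin m → F)
    (e : ℕ) : sliceRank π 1 (e + 1) ≤
      sliceRank (restrictMap π u e) 1 (e + 1) + sliceRank π (affineForm u) e := by
  refine (finrank_le_finrank_map_mkQ_add _ _).trans (Nat.add_le_add_right ?_ _)
  refine Submodule.finrank_mono ?_
  rintro _ ⟨_, ⟨f, hf, rfl⟩, rfl⟩
  refine ⟨hyperplaneRestrict u f, isHomogeneous_hyperplaneRestrict u hf, ?_⟩
  simp only [restrictMap, LinearMap.comp_apply, LinearMap.mulLeft_apply, one_mul,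
    AlgHom.toLinearMap_apply]
  refine (mkQ_eq_of_dvd π u hf ?_ (affineForm_dvd_sub_liftSucc u f)).symm
  exact isHomogeneous_liftSucc (isHomogeneous_hyperplaneRestrict u hf)

lemma sliceRank_restrictMap_le (π : MvPolynomial (Fin (m + 1)) F →ₗ[F] A) (u : Fin m → F)
    {i e' e : ℕ} (hie : i + e' = e + 1) {p : MvPolynomial (Fin (m + 1)) F}
    {r : MvPolynomial (Fin m) F} {c : F} (hc : c ≠ 0) (hp : p.IsHomogeneous i)
    (hr : r.IsHomogeneous i) (h : affineForm u ∣ p - C c * liftSucc F m r) :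
    sliceRank (restrictMap π u e) r e' ≤ Module.finrank F
      (((homogeneousSubmodule (Fin (m + 1)) F e').map (π ∘ₗ LinearMap.mulLeft F p)).map
        (Submodule.mkQ ((homogeneousSubmodule (Fin (m + 1)) F e).map
        (π ∘ₗ LinearMap.mulLeft F (affineForm u))))) := by
  refine Submodule.finrank_mono ?_
  rintro _ ⟨f, hf, rfl⟩
  have hf' : (liftSucc F m f).IsHomogeneous e' := isHomogeneous_liftSucc hf
  refine ⟨_, ⟨C c⁻¹ * liftSucc F m f, hf'.C_mul _, rfl⟩, ?_⟩
  simp only [restrictMap, LinearMap.comp_apply, LinearMap.mulLeft_apply, map_mul,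
    AlgHom.toLinearMap_apply]
  have hcc : (C c⁻¹ * C c : MvPolynomial (Fin (m + 1)) F) = 1 := by
    rw [← C_mul, inv_mul_cancel₀ hc, C_1]
  refine mkQ_eq_of_dvd π u ?_ ?_ ?_
  · rw [← hie]
    exact hp.mul (hf'.C_mul _)
  · rw [← hie]
    exact (isHomogeneous_liftSucc hr).mul hf'
  · have := h.mul_right (C c⁻¹ * liftSucc F m f)
    convert this using 1
    linear_combination (liftSucc F m r * liftSucc F m f) * hcc

lemma sliceRank_restrictMap_add_le (π : MvPolynomial (Fin (m + 1)) F →ₗ[F] A) (u : Fin m → F)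
    {i e' e : ℕ} (hie : i + (e' + 1) = e + 1) {p : MvPolynomial (Fin (m + 1)) F}
    {r : MvPolynomial (Fin m) F} {c : F} (hc : c ≠ 0) (hp : p.IsHomogeneous i)
    (hr : r.IsHomogeneous i) (h : affineForm u ∣ p - C c * liftSucc F m r) :
    sliceRank (restrictMap π u e) r (e' + 1) + sliceRank π (p * affineForm u) e' ≤
      sliceRank π p (e' + 1) := by
  refine (Nat.add_le_add_right (sliceRank_restrictMap_le π u hie hc hp hr h) _).trans ?_
  refine finrank_map_add_finrank_le _ ?_ ?_
  · rintro _ ⟨f, hf, rfl⟩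
    refine ⟨affineForm u * f, ?_, by simp⟩
    rw [add_comm e' 1]
    exact (isHomogeneous_affineForm u).mul hf
  · rw [Submodule.ker_mkQ]
    rintro _ ⟨f, hf, rfl⟩
    refine ⟨p * f, ?_, by simp only [LinearMap.comp_apply, LinearMap.mulLeft_apply]; ring_nf⟩
    obtain rfl : e = i + e' := by omega
    exact hp.mul hf

lemma sliceRank_restrictMap_le_sliceRank (π : MvPolynomial (Fin (m + 1)) F →ₗ[F] A)
    (u : Fin m → F) {i e' e : ℕ} (hie : i + e' = e + 1) {p : MvPolynomial (Fin (m + 1)) F}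
    {r : MvPolynomial (Fin m) F} {c : F} (hc : c ≠ 0) (hp : p.IsHomogeneous i)
    (hr : r.IsHomogeneous i) (h : affineForm u ∣ p - C c * liftSucc F m r) :
    sliceRank (restrictMap π u e) r e' ≤ sliceRank π p e' :=
  (sliceRank_restrictMap_le π u hie hc hp hr h).trans (Submodule.finrank_map_le _ _)

/-- Multiplication by a random `affineForm` keeps at least the proportion `D / (D + m)` of the
rank that any linear map has in degree `e + 1`. -/
def SliceBound (F : Type) [Field F] [Fintype F] (m : ℕ) : Prop :=
  ∀ (A : Type) [AddCommGroup A] [Module F A] (π : MvPolynomial (Fin (m + 1)) F →ₗ[F] A)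
    (e D : ℕ), D ≤ e + 1 → D + 1 ≤ Fintype.card F →
    (D : ℝ) / (D + m) * sliceRank π 1 (e + 1) ≤
      Finset.univ.expect fun u : Fin m → F => (sliceRank π (affineForm u) e : ℝ)

/-- The proportion of the rank kept after multiplication by `i` random forms. -/
noncomputable def keptProportion (m D i : ℕ) : ℝ :=
  ∏ j ∈ Finset.range i, ((D - j : ℕ) : ℝ) / ((D - j : ℕ) + m)

lemma keptProportion_nonneg (m D i : ℕ) : 0 ≤ keptProportion m D i :=
  Finset.prod_nonneg fun _ _ => by positivity

lemma sum_keptProportion (m D : ℕ) :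
    (∑ i ∈ Finset.range (D + 1), keptProportion m D i) * (m + 1) = D + m + 1 := by
  induction D with
  | zero => simp [keptProportion]
  | succ D ih =>
    have h : ∀ i, keptProportion m (D + 1) (i + 1) =
        ((D + 1 : ℕ) : ℝ) / ((D + 1 : ℕ) + m) * keptProportion m D i := by
      intro i
      simp only [keptProportion, Finset.prod_range_succ']
      rw [mul_comm]
      simp [Nat.add_sub_add_right]
    rw [Finset.sum_range_succ']
    simp_rw [h]
    rw [← Finset.mul_sum, add_mul, mul_assoc, ih]
    have : (0 : ℝ) < (D + 1 : ℕ) + m := by positivity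
    simp only [keptProportion, Finset.range_zero, Finset.prod_empty]
    push_cast at this ⊢
    field_simp
    ring

lemma expect_fin_succ {X : Type} [Fintype X] {i : ℕ} (f : (Fin (i + 1) → X) → ℝ) :
    (Finset.univ.expect f) = Finset.univ.expect fun u : Fin i → X =>
      Finset.univ.expect fun x : X => f (Fin.snoc u x) := by
  rw [← Fintype.expect_equiv (Fin.snocEquiv fun _ => X) (fun y => f (Fin.snoc y.2 y.1)) f
    (fun _ => rfl), ← Finset.univ_product_univ, Finset.expect_product, Finset.expect_comm]

lemma keptProportion_mul_le_expect [Fintype F] (hm : SliceBound F m)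
    (π : MvPolynomial (Fin (m + 1)) F →ₗ[F] A) {d D : ℕ} (hD : D ≤ d)
    (hq : D + 1 ≤ Fintype.card F) (i : ℕ) (hi : i ≤ D) :
    keptProportion m D i * sliceRank π 1 d ≤ Finset.univ.expect fun u : Fin i → Fin m → F =>
      (sliceRank π (∏ j, affineForm (u j)) (d - i) : ℝ) := by
  induction i with
  | zero => simp [keptProportion]
  | succ i ih =>
    have ih := ih (by omega)
    rw [expect_fin_succ]
    calc keptProportion m D (i + 1) * sliceRank π 1 d
        = ((D - i : ℕ) : ℝ) / ((D - i : ℕ) + m) * (keptProportion m D i * sliceRank π 1 d) := by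
          rw [keptProportion, Finset.prod_range_succ, keptProportion]; ring
      _ ≤ ((D - i : ℕ) : ℝ) / ((D - i : ℕ) + m) *
          Finset.univ.expect fun u : Fin i → Fin m → F =>
            (sliceRank π (∏ j, affineForm (u j)) (d - i) : ℝ) := by gcongr
      _ ≤ _ := by
          rw [Finset.mul_expect]
          refine Finset.expect_le_expect fun u _ => ?_
          have := hm A (π ∘ₗ LinearMap.mulLeft F (∏ j, affineForm (u j))) (d - (i + 1)) (D - i)
            (by omega) (by omega)
          rw [show d - (i + 1) + 1 = d - i by omega] at this
          simpa [sliceRank_comp_mulLeft, Fin.prod_univ_castSucc] using this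

end Averaging

section SliceBound

variable {F : Type} [Field F] {m : ℕ} {A : Type} [AddCommGroup A] [Module F A]

lemma sliceBound_zero [Fintype F] : SliceBound F 0 := by
  intro A _ _ π e D _ _
  have h : sliceRank π 1 (e + 1) ≤ sliceRank π (affineForm (default : Fin 0 → F)) e := by
    refine (sliceRank_one_le_restrictMap π default e).trans ?_
    have h0 : homogeneousSubmodule (Fin 0) F (e + 1) = ⊥ := by
      refine (Submodule.eq_bot_iff _).2 fun f hf => ?_
      by_contra hne
      exact absurd ((isHomogeneous_of_isEmpty (f := f)).inj_right hf hne) (by omega)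
    simp [sliceRank, h0]
  have h' : (sliceRank π 1 (e + 1) : ℝ) ≤ sliceRank π (affineForm (default : Fin 0 → F)) e := by
    exact_mod_cast h
  rw [Finset.univ_unique, Finset.expect_singleton]
  refine le_trans ?_ h'
  simpa using mul_le_mul_of_nonneg_right (div_self_le_one (D : ℝ))
    (Nat.cast_nonneg (sliceRank π 1 (e + 1)))

lemma dvd_prod_sub_prod {R ι : Type} [CommRing R] (s : Finset ι) {l : R} {f g : ι → R}
    (h : ∀ i ∈ s, l ∣ f i - g i) : l ∣ ∏ i ∈ s, f i - ∏ i ∈ s, g i := by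
  rw [← Ideal.mem_span_singleton, ← Ideal.Quotient.mk_eq_mk_iff_sub_mem, map_prod, map_prod]
  refine Finset.prod_congr rfl fun i hi => ?_
  rw [Ideal.Quotient.mk_eq_mk_iff_sub_mem, Ideal.mem_span_singleton]
  exact h i hi

lemma affineForm_dvd_affineForm_sub {a b : F} (hab : b - a ≠ 0) (x y : Fin m → F) :
    affineForm (Fin.cons a x : Fin (m + 1) → F) ∣ affineForm (Fin.cons b y : Fin (m + 1) → F) -
      C (b - a) * liftSucc F m.succ (affineForm fun k => (y k - x k) / (b - a)) := by
  refine dvd_of_eq ?_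
  obtain ⟨c, rfl⟩ : ∃ c, b = c + a := ⟨b - a, by ring⟩
  rw [add_sub_cancel_right] at hab ⊢
  have h : ∀ k, C c * C ((y k - x k) / c) =
      (C (y k) - C (x k) : MvPolynomial (Fin (m + 2)) F) := by
    intro k
    rw [← C_mul, mul_div_cancel₀ _ hab, C_sub]
  simp only [affineForm, Fin.sum_univ_succ, Fin.cons_zero, Fin.cons_succ, liftSucc, map_add,
    map_sum, map_mul, rename_X, rename_C, mul_add, Finset.mul_sum, ← mul_assoc, h, sub_mul,
    Finset.sum_sub_distrib, Nat.succ_eq_add_one]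
  ring

lemma affineForm_dvd_prod_sub {i : ℕ} {a : F} {b : Fin i → F} (hab : ∀ j, b j - a ≠ 0)
    (x : Fin m → F) (y : Fin i → Fin m → F) :
    affineForm (Fin.cons a x : Fin (m + 1) → F) ∣
      ∏ j, affineForm (Fin.cons (b j) (y j) : Fin (m + 1) → F) -
        C (∏ j, (b j - a)) *
          liftSucc F m.succ (∏ j, affineForm fun k => (y j k - x k) / (b j - a)) := by
  rw [map_prod, map_prod, ← Finset.prod_mul_distrib]
  exact dvd_prod_sub_prod _ fun j _ => affineForm_dvd_affineForm_sub (hab j) x (y j)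

lemma isHomogeneous_prod_affineForm {i : ℕ} (u : Fin i → Fin m → F) :
    (∏ j, affineForm (u j)).IsHomogeneous i := by
  simpa using IsHomogeneous.prod Finset.univ (fun j => affineForm (u j)) (fun _ => 1)
    fun j _ => isHomogeneous_affineForm (u j)

/-- Passing to slopes relative to a base point, coordinate by coordinate. -/
def slopeEquiv {i : ℕ} {c : Fin i → F} (hc : ∀ j, c j ≠ 0) (x : Fin m → F) :
    (Fin i → Fin m → F) ≃ (Fin i → Fin m → F) where
  toFun y j k := (y j k - x k) / c j
  invFun z j k := z j k * c j + x k
  left_inv y := by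
    ext j k
    simp [hc j]
  right_inv z := by
    ext j k
    simp [hc j]

lemma expect_cons [Fintype F] (a : F) (f : (Fin (m + 1) → F) → ℝ) :
    (Finset.univ.expect fun s : F => Finset.univ.expect fun x : Fin m → F =>
      f (Fin.cons (a + s) x)) = Finset.univ.expect f := by
  rw [← Finset.expect_product', Finset.univ_product_univ]
  exact Fintype.expect_equiv (((Equiv.addLeft a).prodCongr (Equiv.refl _)).trans
    (Fin.consEquiv fun _ => F)) _ _ fun _ => rfl

lemma keptProportion_mul_expect_le [Fintype F] (hm : SliceBound F m)
    (π : MvPolynomial (Fin (m + 2)) F →ₗ[F] A) {e D i : ℕ} (hD : D ≤ e + 1)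
    (hq : D + 1 ≤ Fintype.card F) (hi : i ≤ D) {a : F} {b : Fin i → F}
    (hab : ∀ j, b j - a ≠ 0) :
    keptProportion m D i * (Finset.univ.expect fun v : Fin (m + 1) → F =>
        (sliceRank π 1 (e + 1) - sliceRank π (affineForm v) e : ℝ)) ≤
      Finset.univ.expect fun s : F => Finset.univ.expect fun x : Fin m → F =>
        Finset.univ.expect fun y : Fin i → Fin m → F =>
          (sliceRank (restrictMap π (Fin.cons (a + s) x : Fin (m + 1) → F) e)
            (∏ j, affineForm fun k => (y j k - x k) / (b j - a)) (e + 1 - i) : ℝ) := by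
  rw [← expect_cons a, Finset.mul_expect]
  refine Finset.expect_le_expect fun s _ => ?_
  rw [Finset.mul_expect]
  refine Finset.expect_le_expect fun x _ => ?_
  refine le_trans ?_ (Fintype.expect_equiv (slopeEquiv hab x) _ (fun z : Fin i → Fin m → F =>
    (sliceRank (restrictMap π (Fin.cons (a + s) x : Fin (m + 1) → F) e)
      (∏ j, affineForm (z j)) (e + 1 - i) : ℝ)) fun y => rfl).ge
  refine le_trans ?_ (keptProportion_mul_le_expect hm _ hD hq i hi)
  refine mul_le_mul_of_nonneg_left ?_ (keptProportion_nonneg _ _ _)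
  rw [sub_le_iff_le_add]
  exact_mod_cast sliceRank_one_le_restrictMap π _ e

lemma exists_injOn_range [Fintype F] {D : ℕ} (hq : D + 1 ≤ Fintype.card F) :
    ∃ t : ℕ → F, ∀ i ≤ D, ∀ j < i, t j - t i ≠ 0 := by
  refine ⟨fun i => if h : i < Fintype.card F then (Fintype.equivFin F).symm ⟨i, h⟩ else 0, ?_⟩
  intro i hi j hj
  simp only [dif_pos (show i < Fintype.card F by omega), dif_pos (show j < Fintype.card F by omega)]
  rw [sub_ne_zero]
  intro h
  have := (Fintype.equivFin F).symm.injective h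
  simp only [Fin.mk.injEq] at this
  omega

lemma SliceBound.succ [Fintype F] (hm : SliceBound F m) : SliceBound F (m + 1) := by
  intro A _ _ π e D hD hq
  obtain ⟨t, ht⟩ := exists_injOn_range hq
  set a : ℕ → ℝ := fun i => Finset.univ.expect fun s : F =>
    Finset.univ.expect fun y : Fin i → Fin m → F =>
      (sliceRank π (∏ j : Fin i, affineForm (Fin.cons (t j + s) (y j) : Fin (m + 1) → F))
        (e + 1 - i) : ℝ) with ha
  set T : ℝ := Finset.univ.expect fun v : Fin (m + 1) → F =>
    (sliceRank π 1 (e + 1) - sliceRank π (affineForm v) e : ℝ) with hT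
  have hne : ∀ i ≤ D, ∀ j : Fin i, t j - t i ≠ 0 := fun i hi j => ht i hi j j.2
  have hdvd : ∀ i ≤ D, ∀ (s : F) (x : Fin m → F) (y : Fin i → Fin m → F),
      affineForm (Fin.cons (t i + s) x : Fin (m + 1) → F) ∣
      ∏ j : Fin i, affineForm (Fin.cons (t j + s) (y j) : Fin (m + 1) → F) -
        C (∏ j : Fin i, (t j - t i)) *
          liftSucc F m.succ (∏ j, affineForm fun k => (y j k - x k) / (t j - t i)) := by
    intro i hi s x y
    have := affineForm_dvd_prod_sub (a := t i + s) (b := fun j : Fin i => t j + s)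
      (by simpa using hne i hi) x y
    simpa only [add_sub_add_right_eq_sub] using this
  have hstep : ∀ i < D, keptProportion m D i * T ≤ a i - a (i + 1) := by
    intro i hi
    refine (keptProportion_mul_expect_le hm π hD hq hi.le (hne i hi.le)).trans ?_
    rw [ha]
    simp only
    rw [← Finset.expect_sub_distrib]
    refine Finset.expect_le_expect fun s _ => ?_
    rw [expect_fin_succ, ← Finset.expect_sub_distrib, Finset.expect_comm]
    refine Finset.expect_le_expect fun y _ => ?_
    rw [le_sub_iff_add_le, ← Finset.expect_add_distrib]
    refine Finset.expect_le (Finset.univ_nonempty) fun x _ => ?_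
    simp only [Fin.prod_univ_castSucc, Fin.snoc_castSucc, Fin.snoc_last, Fin.val_castSucc,
      Fin.val_last]
    rw [show e + 1 - i = (e + 1 - (i + 1)) + 1 by omega]
    exact_mod_cast sliceRank_restrictMap_add_le π _ (by omega)
      (Finset.prod_ne_zero_iff.2 fun j _ => hne i hi.le j)
      (isHomogeneous_prod_affineForm _) (isHomogeneous_prod_affineForm _) (hdvd i hi.le s x y)
  have hlast : keptProportion m D D * T ≤ a D := by
    refine (keptProportion_mul_expect_le hm π hD hq le_rfl (hne D le_rfl)).trans ?_
    refine Finset.expect_le_expect fun s _ => ?_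
    rw [Finset.expect_comm]
    refine Finset.expect_le_expect fun y _ => ?_
    refine Finset.expect_le (Finset.univ_nonempty) fun x _ => ?_
    exact_mod_cast sliceRank_restrictMap_le_sliceRank π _ (by omega)
      (Finset.prod_ne_zero_iff.2 fun j _ => hne D le_rfl j)
      (isHomogeneous_prod_affineForm _) (isHomogeneous_prod_affineForm _) (hdvd D le_rfl s x y)
  have ha0 : a 0 = sliceRank π 1 (e + 1) := by simp [ha]
  have hsum : (∑ i ∈ Finset.range (D + 1), keptProportion m D i) * T ≤ a 0 := by
    rw [Finset.sum_range_succ, add_mul, Finset.sum_mul]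
    have := Finset.sum_le_sum fun i hi => hstep i (Finset.mem_range.1 hi)
    rw [Finset.sum_range_sub'] at this
    linarith
  have hT' : T = sliceRank π 1 (e + 1) -
      Finset.univ.expect fun v : Fin (m + 1) → F => (sliceRank π (affineForm v) e : ℝ) := by
    rw [hT, Finset.expect_sub_distrib, Fintype.expect_const]
  have hw := sum_keptProportion m D
  rw [ha0] at hsum
  set E := Finset.univ.expect fun v : Fin (m + 1) → F => (sliceRank π (affineForm v) e : ℝ)
  set W := ∑ i ∈ Finset.range (D + 1), keptProportion m D i
  have hm0 : (0 : ℝ) < m + 1 := by positivity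
  have h1 : (W * (m + 1)) * T ≤ sliceRank π 1 (e + 1) * (m + 1) := by nlinarith
  rw [hw, hT'] at h1
  have hpos : (0 : ℝ) < D + (m + 1 : ℕ) := by positivity
  rw [div_mul_eq_mul_div, div_le_iff₀ hpos]
  push_cast
  nlinarith

theorem sliceBound [Fintype F] (m : ℕ) : SliceBound F m := by
  induction m with
  | zero => exact sliceBound_zero
  | succ m ih => exact ih.succ

end SliceBound

section HilbertFunction

variable {F : Type} [Field F] {m n : ℕ}

/-- The dimension of the degree `d` part of the quotient by `I`. -/
noncomputable def hilb (I : Ideal (MvPolynomial (Fin n) F)) (d : ℕ) : ℕ :=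
  sliceRank (Ideal.Quotient.mkₐ F I).toLinearMap 1 d

lemma finrank_homogeneousSubmodule (n d : ℕ) :
    Module.finrank F (homogeneousSubmodule (Fin n) F d) = n.multichoose d := by
  have hs : {s : Fin n →₀ ℕ | s.degree = d} =
      ((Finset.univ.finsuppAntidiag d : Finset (Fin n →₀ ℕ)) : Set (Fin n →₀ ℕ)) := by
    ext s
    simp [Finsupp.degree_eq_sum]
  rw [homogeneousSubmodule_eq_finsupp_supported, hs]
  rw [(AddMonoidAlgebra.supportedEquivFinsupp _).finrank_eq]
  simp [Finset.card_finsuppAntidiag_nat_eq_multichoose]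

lemma hilb_le_multichoose (I : Ideal (MvPolynomial (Fin n) F)) (d : ℕ) :
    hilb I d ≤ n.multichoose d := by
  rw [← finrank_homogeneousSubmodule (F := F)]
  exact Submodule.finrank_map_le _ _

lemma hilb_map_add_finrank_le (I : Ideal (MvPolynomial (Fin (m + 1)) F)) (u : Fin m → F) (d : ℕ)
    {N : Submodule F (MvPolynomial (Fin (m + 1)) F)} (hN : N ≤ homogeneousSubmodule _ F d)
    (hNu : N ≤ LinearMap.ker (hyperplaneRestrict u).toLinearMap) :
    hilb (I.map (hyperplaneRestrict u)) d +
      Module.finrank F (N.map (Ideal.Quotient.mkₐ F I).toLinearMap) ≤ hilb I d := by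
  set ψ := Ideal.quotientMapₐ (I.map (hyperplaneRestrict u)) (hyperplaneRestrict u)
    Ideal.le_comap_map
  have h1 : LinearMap.mulLeft F (1 : MvPolynomial (Fin (m + 1)) F) = LinearMap.id := by
    ext; simp
  refine le_trans (Nat.add_le_add_right ?_ _)
    (finrank_map_add_finrank_le ψ.toLinearMap (N := N.map (Ideal.Quotient.mkₐ F I).toLinearMap)
      ?_ ?_)
  · refine Submodule.finrank_mono ?_
    rintro _ ⟨f, hf, rfl⟩
    refine ⟨_, ⟨liftSucc F m f, isHomogeneous_liftSucc hf, rfl⟩, ?_⟩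
    simp [ψ, hyperplaneRestrict_liftSucc]
  · rw [h1, LinearMap.comp_id]
    exact Submodule.map_mono hN
  · rintro _ ⟨f, hf, rfl⟩
    have : hyperplaneRestrict u f = 0 := hNu hf
    simp [ψ, this]

lemma hilb_map_le (I : Ideal (MvPolynomial (Fin (m + 1)) F)) (u : Fin m → F) (d : ℕ) :
    hilb (I.map (hyperplaneRestrict u)) d ≤ hilb I d :=
  le_of_add_le_left (hilb_map_add_finrank_le I u d bot_le bot_le)

lemma hilb_map_add_sliceRank_le (I : Ideal (MvPolynomial (Fin (m + 1)) F)) (u : Fin m → F)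
    (e : ℕ) : hilb (I.map (hyperplaneRestrict u)) (e + 1) +
      sliceRank (Ideal.Quotient.mkₐ F I).toLinearMap (affineForm u) e ≤ hilb I (e + 1) := by
  rw [sliceRank, Submodule.map_comp]
  refine hilb_map_add_finrank_le I u _ ?_ ?_
  · rintro _ ⟨f, hf, rfl⟩
    rw [add_comm e 1]
    exact (isHomogeneous_affineForm u).mul hf
  · rintro _ ⟨f, hf, rfl⟩
    simp [hyperplaneRestrict_affineForm]

lemma expect_hilb_map_le [Fintype F] (hm : 0 < m) (I : Ideal (MvPolynomial (Fin (m + 1)) F))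
    {d D : ℕ} (hD : D ≤ d) (hq : D + 1 ≤ Fintype.card F) :
    (Finset.univ.expect fun u : Fin m → F => (hilb (I.map (hyperplaneRestrict u)) d : ℝ)) ≤
      (m : ℝ) / (D + m) * hilb I d := by
  have hm' : (0 : ℝ) < m := by exact_mod_cast hm
  cases d with
  | zero =>
    obtain rfl : D = 0 := by omega
    rw [Nat.cast_zero, zero_add, div_self hm'.ne', one_mul]
    exact Finset.expect_le Finset.univ_nonempty fun u _ => by exact_mod_cast hilb_map_le I u 0
  | succ e =>
    have h := sliceBound (F := F) m _ (Ideal.Quotient.mkₐ F I).toLinearMap e D hD hq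
    have h2 : (Finset.univ.expect fun u : Fin m → F =>
        (hilb (I.map (hyperplaneRestrict u)) (e + 1) +
          sliceRank (Ideal.Quotient.mkₐ F I).toLinearMap (affineForm u) e : ℝ)) ≤
        hilb I (e + 1) :=
      Finset.expect_le Finset.univ_nonempty fun u _ => by
        exact_mod_cast hilb_map_add_sliceRank_le I u e
    rw [Finset.expect_add_distrib] at h2
    have h3 : (m : ℝ) / (D + m) = 1 - D / (D + m) := by
      field_simp
      ring
    rw [h3, sub_mul, one_mul]
    have h4 : (hilb I (e + 1) : ℝ) =
      sliceRank (Ideal.Quotient.mkₐ F I).toLinearMap 1 (e + 1) := rfl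
    rw [← h4] at h
    linarith

lemma finrank_quotient_le_sum_hilb (I J : Ideal (MvPolynomial (Fin n) F)) {E : ℕ}
    (hE : ∀ d, E ≤ d → hilb I d = 0) :
    Module.finrank F (MvPolynomial (Fin n) F ⧸ (I + J)) ≤ ∑ d ∈ Finset.range E, hilb I d := by
  set M : ℕ → Submodule F (MvPolynomial (Fin n) F ⧸ I) := fun d =>
    (homogeneousSubmodule (Fin n) F d).map
      ((Ideal.Quotient.mkₐ F I).toLinearMap ∘ₗ LinearMap.mulLeft F 1) with hM
  have hM0 : ∀ d, E ≤ d → M d = ⊥ := fun d hd => Submodule.finrank_eq_zero.1 (hE d hd)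
  have hmem : ∀ d f, Ideal.Quotient.mk I (homogeneousComponent d f) ∈ M d := fun d f =>
    ⟨homogeneousComponent d f, homogeneousComponent_isHomogeneous _ _, by simp⟩
  let Φ : ((d : Fin E) → M d) →ₗ[F] MvPolynomial (Fin n) F ⧸ (I + J) :=
    (Ideal.Quotient.factorₐ F (le_sup_left : I ≤ I + J)).toLinearMap ∘ₗ
      ∑ d : Fin E, (M d).subtype ∘ₗ LinearMap.proj d
  have hΦ : Function.Surjective Φ := by
    intro y
    obtain ⟨f, rfl⟩ := Ideal.Quotient.mk_surjective y
    refine ⟨fun d => ⟨_, hmem d f⟩, ?_⟩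
    have h : ∑ d : Fin E, Ideal.Quotient.mk I (homogeneousComponent d f) =
        Ideal.Quotient.mk I f := by
      conv_rhs => rw [← sum_homogeneousComponent f, map_sum]
      rw [Fin.sum_univ_eq_sum_range (fun d => Ideal.Quotient.mk I (homogeneousComponent d f))]
      rcases le_total E (f.totalDegree + 1) with h | h
      · refine Finset.sum_subset (Finset.range_mono h) fun d _ hd => ?_
        have := hmem d f
        rwa [hM0 d (by simpa using hd), Submodule.mem_bot] at this
      · refine (Finset.sum_subset (Finset.range_mono h) fun d _ hd => ?_).symm
        rw [homogeneousComponent_eq_zero _ _ (by simpa using hd), map_zero]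
    simp only [Φ, LinearMap.comp_apply, LinearMap.sum_apply, LinearMap.proj_apply,
      Submodule.subtype_apply, h, AlgHom.toLinearMap_apply]
    rfl
  refine (LinearMap.finrank_le_finrank_of_surjective hΦ).trans_eq ?_
  rw [Module.finrank_pi_fintype, Finset.sum_range]
  rfl

lemma sum_hilb_le_finrank {I : Ideal (MvPolynomial (Fin n) F)} (hI : IsHomogeneousIdeal I)
    [FiniteDimensional F (MvPolynomial (Fin n) F ⧸ I)] (s : Finset ℕ) :
    ∑ d ∈ s, hilb I d ≤ Module.finrank F (MvPolynomial (Fin n) F ⧸ I) := by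
  set π := (Ideal.Quotient.mkₐ F I).toLinearMap
  have hπ : Function.Surjective π := Ideal.Quotient.mk_surjective
  set M : ℕ → Submodule F (MvPolynomial (Fin n) F ⧸ I) := fun d =>
    (homogeneousSubmodule (Fin n) F d).map (π ∘ₗ LinearMap.mulLeft F 1) with hM
  have hmem : ∀ d f, π (homogeneousComponent d f) ∈ M d := fun d f =>
    ⟨homogeneousComponent d f, homogeneousComponent_isHomogeneous _ _, by simp⟩
  let Φ : MvPolynomial (Fin n) F →ₗ[F] ((d : s) → M d) :=
    LinearMap.pi fun d => (π ∘ₗ homogeneousComponent (d : ℕ)).codRestrict (M d) (hmem d)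
  have hker : LinearMap.ker π ≤ LinearMap.ker Φ := by
    intro f hf
    have hf : f ∈ I := Ideal.Quotient.eq_zero_iff_mem.1 hf
    ext d
    exact Ideal.Quotient.eq_zero_iff_mem.2 (hI f hf d)
  have hΦ : Function.Surjective Φ := by
    intro y
    have hy : ∀ d : s, ∃ f, f.IsHomogeneous (d : ℕ) ∧ π f = y d := by
      intro d
      obtain ⟨f, hf, hfy⟩ := (y d).2
      exact ⟨f, hf, by simpa using hfy⟩
    choose f hf hfy using hy
    refine ⟨∑ d, f d, ?_⟩
    ext d
    have : homogeneousComponent (d : ℕ) (∑ d, f d) = f d := by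
      rw [map_sum, Finset.sum_eq_single d]
      · exact homogeneousComponent_eq_self (hf d)
      · intro b _ hb
        rw [homogeneousComponent_of_mem (hf b), if_neg]
        exact fun h => hb (Subtype.ext h.symm)
      · simp
    change π (homogeneousComponent (d : ℕ) (∑ d, f d)) = y d
    rw [this, hfy]
  have e := π.quotKerEquivOfSurjective hπ
  have : Module.Finite F (MvPolynomial (Fin n) F ⧸ LinearMap.ker π) := Module.Finite.equiv e.symm
  rw [← e.finrank_eq]
  refine le_trans (Eq.le ?_) (LinearMap.finrank_le_finrank_of_surjective
    (f := (LinearMap.ker π).liftQ Φ hker) ?_)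
  · rw [Module.finrank_pi_fintype, ← Finset.sum_coe_sort]
    rfl
  · intro y
    obtain ⟨f, hf⟩ := hΦ y
    exact ⟨Submodule.Quotient.mk f, hf⟩

lemma exists_hilb_eq_zero {I : Ideal (MvPolynomial (Fin n) F)} (hI : IsHomogeneousIdeal I)
    [FiniteDimensional F (MvPolynomial (Fin n) F ⧸ I)] : ∃ E, ∀ d, E ≤ d → hilb I d = 0 := by
  have hfin : {d | hilb I d ≠ 0}.Finite := by
    by_contra hinf
    obtain ⟨s, hs, hcard⟩ := Set.Infinite.exists_subset_card_eq hinf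
      (Module.finrank F (MvPolynomial (Fin n) F ⧸ I) + 1)
    have h1 := sum_hilb_le_finrank hI s
    have h2 : s.card • 1 ≤ ∑ d ∈ s, hilb I d :=
      Finset.card_nsmul_le_sum _ _ _ fun d hd => Nat.one_le_iff_ne_zero.2 (hs hd)
    simp only [smul_eq_mul, mul_one] at h2
    omega
  obtain ⟨b, hb⟩ := hfin.bddAbove
  refine ⟨b + 1, fun d hd => ?_⟩
  by_contra h
  have := hb h
  omega

end HilbertFunction

section Propagation

variable {F : Type} [Field F] {m : ℕ}

/-- The parametrisation `v ↦ (-∑ uᵢ vᵢ, v)` of the hyperplane on which `affineForm u` vanishes. -/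
noncomputable def hyperplaneParam (u : Fin m → F) : (Fin m → F) →ₗ[F] (Fin (m + 1) → F) :=
  LinearMap.pi (Fin.cons (-∑ i, u i • LinearMap.proj i) LinearMap.proj)

lemma hyperplaneParam_apply (u v : Fin m → F) :
    hyperplaneParam u v = Fin.cons (-∑ i, u i * v i) v := by
  ext i
  refine Fin.cases ?_ (fun i => ?_) i <;> simp [hyperplaneParam]

lemma hyperplaneParam_injective (u : Fin m → F) : Function.Injective (hyperplaneParam u) := by
  intro v w h
  simp only [hyperplaneParam_apply] at h
  exact (Fin.cons_inj.1 h).2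

lemma affineForm_mem_linearSubspaceIdeal (u : Fin m → F) (V : Submodule F (Fin m → F)) :
    affineForm u ∈ linearSubspaceIdeal F (m + 1) (V.map (hyperplaneParam u)) := by
  refine Ideal.subset_span ⟨isHomogeneous_affineForm u, ?_⟩
  rintro _ ⟨v, -, rfl⟩
  simp [hyperplaneParam_apply, affineForm]

lemma liftSucc_mem_linearSubspaceIdeal (u : Fin m → F) (V : Submodule F (Fin m → F))
    {g : MvPolynomial (Fin m) F} (hg : g ∈ linearSubspaceIdeal F m V) :
    liftSucc F m g ∈ linearSubspaceIdeal F (m + 1) (V.map (hyperplaneParam u)) := by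
  suffices h : linearSubspaceIdeal F m V ≤
      (linearSubspaceIdeal F (m + 1) (V.map (hyperplaneParam u))).comap (liftSucc F m) from h hg
  refine Ideal.span_le.2 ?_
  rintro f ⟨hf, hfV⟩
  refine Ideal.subset_span ⟨isHomogeneous_liftSucc hf, ?_⟩
  rintro _ ⟨v, hv, rfl⟩
  rw [hyperplaneParam_apply, liftSucc, eval_rename]
  exact hfV v hv

instance finite_quotient_map_hyperplaneRestrict (I : Ideal (MvPolynomial (Fin (m + 1)) F))
    [FiniteDimensional F (MvPolynomial (Fin (m + 1)) F ⧸ I)] (u : Fin m → F) :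
    FiniteDimensional F (MvPolynomial (Fin m) F ⧸ I.map (hyperplaneRestrict u)) := by
  refine Module.Finite.of_surjective (Ideal.quotientMapₐ (I.map (hyperplaneRestrict u))
    (hyperplaneRestrict u) Ideal.le_comap_map).toLinearMap fun y => ?_
  obtain ⟨f, rfl⟩ := Ideal.Quotient.mk_surjective y
  exact ⟨Ideal.Quotient.mk _ (liftSucc F m f), by simp [hyperplaneRestrict_liftSucc]⟩

lemma finrank_quotient_linearSubspaceIdeal_le (I : Ideal (MvPolynomial (Fin (m + 1)) F))
    [FiniteDimensional F (MvPolynomial (Fin (m + 1)) F ⧸ I)] (u : Fin m → F)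
    (V : Submodule F (Fin m → F)) :
    Module.finrank F (MvPolynomial (Fin (m + 1)) F ⧸
      (I + linearSubspaceIdeal F (m + 1) (V.map (hyperplaneParam u)))) ≤
    Module.finrank F (MvPolynomial (Fin m) F ⧸
      (I.map (hyperplaneRestrict u) + linearSubspaceIdeal F m V)) := by
  set J := I + linearSubspaceIdeal F (m + 1) (V.map (hyperplaneParam u))
  have hsub : ∀ f, f - liftSucc F m (hyperplaneRestrict u f) ∈ J := fun f =>
    Ideal.mem_sup_right (Ideal.mem_of_dvd _ (affineForm_dvd_sub_liftSucc u f)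
      (affineForm_mem_linearSubspaceIdeal u V))
  have hle : I.map (hyperplaneRestrict u) + linearSubspaceIdeal F m V ≤
      J.comap (liftSucc F m) := by
    refine sup_le (Ideal.map_le_iff_le_comap.2 fun f hf => ?_) fun g hg =>
      Ideal.mem_sup_right (liftSucc_mem_linearSubspaceIdeal u V hg)
    have := J.sub_mem (Ideal.mem_sup_left hf : f ∈ J) (hsub f)
    simpa using this
  have : FiniteDimensional F (MvPolynomial (Fin m) F ⧸
      (I.map (hyperplaneRestrict u) + linearSubspaceIdeal F m V)) :=
    Module.Finite.of_surjective (Ideal.Quotient.factorₐ F (le_sup_left :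
      I.map (hyperplaneRestrict u) ≤ _)).toLinearMap
      (Ideal.Quotient.factor_surjective le_sup_left)
  refine LinearMap.finrank_le_finrank_of_surjective
    (f := (Ideal.quotientMapₐ J (liftSucc F m) hle).toLinearMap) fun y => ?_
  obtain ⟨f, rfl⟩ := Ideal.Quotient.mk_surjective y
  refine ⟨Ideal.Quotient.mk _ (hyperplaneRestrict u f), ?_⟩
  simpa using ((Ideal.Quotient.mk_eq_mk_iff_sub_mem _ _).2 (hsub f)).symm

end Propagation

section WeightedSum

variable {F : Type} [Field F]

/-- The factor by which generic restriction from `k + j` to `k` variables shrinks the degree `d`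
part of a homogeneous quotient, the degree being truncated at `Q`. -/
noncomputable def restrictWeight (Q k j d : ℕ) : ℝ :=
  ∏ i ∈ Finset.range j, ((k + i : ℕ) : ℝ) / ((min d Q : ℕ) + (k + i : ℕ))

lemma le_sum_restrictWeight_mul_hilb [Fintype F] {k : ℕ} (hk : 1 ≤ k) {B : ℝ} {E : ℕ} (j : ℕ)
    (I : Ideal (MvPolynomial (Fin (k + j)) F))
    (hfin : FiniteDimensional F (MvPolynomial (Fin (k + j)) F ⧸ I))
    (hE : ∀ d, E ≤ d → hilb I d = 0)
    (hB : ∀ V : Submodule F (Fin (k + j) → F), Module.finrank F V = k →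
      B ≤ Module.finrank F (MvPolynomial (Fin (k + j)) F ⧸
        (I + linearSubspaceIdeal F (k + j) V))) :
    B ≤ ∑ d ∈ Finset.range E, restrictWeight (Fintype.card F - 1) k j d * hilb I d := by
  induction j with
  | zero =>
    refine (hB ⊤ (by simp)).trans ?_
    simp only [restrictWeight, Finset.range_zero, Finset.prod_empty, one_mul]
    exact_mod_cast finrank_quotient_le_sum_hilb I _ hE
  | succ j ih =>
    have hcard : 1 ≤ Fintype.card F := Fintype.card_pos
    have h1 : ∀ u : Fin (k + j) → F, B ≤ ∑ d ∈ Finset.range E,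
        restrictWeight (Fintype.card F - 1) k j d * hilb (I.map (hyperplaneRestrict u)) d := by
      intro u
      refine ih _ (finite_quotient_map_hyperplaneRestrict I u)
        (fun d hd => Nat.le_zero.1 ((hilb_map_le I u d).trans_eq (hE d hd))) fun V hV => ?_
      have e := Submodule.equivMapOfInjective _ (hyperplaneParam_injective u) V
      refine (hB (V.map (hyperplaneParam u)) (e.finrank_eq.symm.trans hV)).trans ?_
      exact_mod_cast finrank_quotient_linearSubspaceIdeal_le I u V
    have h2 : B ≤ Finset.univ.expect fun u : Fin (k + j) → F => ∑ d ∈ Finset.range E,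
        restrictWeight (Fintype.card F - 1) k j d * (hilb (I.map (hyperplaneRestrict u)) d : ℝ) :=
      Finset.le_expect Finset.univ_nonempty fun u _ => h1 u
    refine h2.trans ?_
    rw [Finset.expect_sum_comm]
    refine Finset.sum_le_sum fun d _ => ?_
    rw [← Finset.mul_expect, restrictWeight, restrictWeight, Finset.prod_range_succ, mul_assoc]
    refine mul_le_mul_of_nonneg_left ?_ (Finset.prod_nonneg fun i _ => by positivity)
    have hmin : min d (Fintype.card F - 1) + 1 ≤ Fintype.card F := by omega
    have hpos : 0 < k + j := by omega
    exact expect_hilb_map_le hpos I (min_le_left _ _) hmin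

end WeightedSum

section Numerics

lemma sum_le_sum_of_antitone_weight {w h b : ℕ → ℝ} (hw : Antitone w) (hw0 : ∀ d, 0 < w d)
    (h0 : ∀ d, 0 ≤ h d) (hb : ∀ d, h d ≤ b d) {D E : ℕ} (hDE : D ≤ E)
    (hsum : ∑ d ∈ Finset.range D, w d * b d ≤ ∑ d ∈ Finset.range E, w d * h d) :
    ∑ d ∈ Finset.range D, b d ≤ ∑ d ∈ Finset.range E, h d := by
  rw [← Finset.sum_range_add_sum_Ico _ hDE] at hsum ⊢
  have h1 : ∑ d ∈ Finset.range D, w d * (h d - b d) ≤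
      ∑ d ∈ Finset.range D, w D * (h d - b d) := by
    refine Finset.sum_le_sum fun d hd => ?_
    exact mul_le_mul_of_nonpos_right (hw (Finset.mem_range.1 hd).le) (sub_nonpos.2 (hb d))
  have h2 : ∑ d ∈ Finset.Ico D E, w d * h d ≤ ∑ d ∈ Finset.Ico D E, w D * h d := by
    refine Finset.sum_le_sum fun d hd => ?_
    exact mul_le_mul_of_nonneg_right (hw (Finset.mem_Ico.1 hd).1) (h0 d)
  simp only [mul_sub, Finset.sum_sub_distrib, ← Finset.mul_sum] at h1 h2
  refine le_of_mul_le_mul_left ?_ (hw0 D)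
  linarith

lemma restrictWeight_pos {Q k : ℕ} (hk : 1 ≤ k) (j d : ℕ) : 0 < restrictWeight Q k j d :=
  Finset.prod_pos fun i _ => by positivity

lemma restrictWeight_antitone {Q k : ℕ} (hk : 1 ≤ k) (j : ℕ) :
    Antitone (restrictWeight Q k j) := by
  intro d e hde
  refine Finset.prod_le_prod (fun i _ => by positivity) fun i _ => ?_
  have : min d Q ≤ min e Q := min_le_min_right Q hde
  gcongr

lemma mul_multichoose_succ {n : ℕ} (hn : 1 ≤ n) (d : ℕ) :
    n * (n + 1).multichoose d = (d + n) * n.multichoose d := by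
  obtain ⟨m, rfl⟩ := Nat.exists_eq_add_of_le' hn
  rw [Nat.multichoose_eq, Nat.multichoose_eq]
  have := Nat.choose_mul_succ_eq (m + d) d
  rw [show m + 1 + 1 + d - 1 = m + d + 1 by omega, show m + 1 + d - 1 = m + d by omega]
  rw [show m + d + 1 - d = m + 1 by omega] at this
  linarith

lemma restrictWeight_mul_multichoose {Q k d : ℕ} (hk : 1 ≤ k) (hd : d ≤ Q) (j : ℕ) :
    restrictWeight Q k j d * (k + j).multichoose d = k.multichoose d := by
  induction j with
  | zero => simp [restrictWeight]
  | succ j ih =>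
    rw [← ih, restrictWeight, Finset.prod_range_succ, ← restrictWeight, mul_assoc, min_eq_left hd]
    congr 1
    have h := mul_multichoose_succ (n := k + j) (by omega) d
    have h' : ((k + j : ℕ) : ℝ) * (k + j + 1).multichoose d =
      (d + (k + j : ℕ)) * (k + j).multichoose d := by exact_mod_cast h
    rw [div_mul_eq_mul_div, ← add_assoc, h', mul_div_cancel_left₀]
    positivity

lemma sum_range_multichoose {k : ℕ} (hk : 1 ≤ k) (D : ℕ) :
    ∑ d ∈ Finset.range D, k.multichoose d = (D + k - 1).choose k := by
  obtain ⟨k, rfl⟩ := Nat.exists_eq_add_of_le' hk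
  induction D with
  | zero => simp
  | succ D ih =>
    rw [Finset.sum_range_succ, ih, Nat.multichoose_eq,
      show D + 1 + (k + 1) - 1 = (D + k) + 1 by omega, Nat.choose_succ_succ,
      show k + 1 + D - 1 = D + k by omega, show D + (k + 1) - 1 = D + k by omega,
      ← Nat.choose_symm_add, add_comm]

lemma pow_div_factorial_le_choose (n D : ℕ) :
    (D : ℝ) ^ n / n.factorial ≤ (D + n - 1).choose n := by
  rw [div_le_iff₀ (by positivity), mul_comm]
  cases D with
  | zero => rcases n with _ | n <;> simp
  | succ D =>
    have h := Nat.pow_succ_le_ascFactorial (D + 1) n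
    rw [Nat.ascFactorial_eq_factorial_mul_choose] at h
    rw [show D + 1 + n - 1 = D + n by omega]
    exact_mod_cast h

/-- A constant error term is negligible against `q ^ a`, for `a > 0`. -/
lemma exists_one_sub_mul_rpow_pow_le {a : ℝ} (ha : 0 < a) (b : ℝ) (n : ℕ) {ε : ℝ} (hε : 0 < ε) :
    ∃ q₀ : ℕ, ∀ q : ℕ, q₀ ≤ q →
      b ≤ (q : ℝ) ^ a ∧ (1 - ε) * ((q : ℝ) ^ a) ^ n ≤ ((q : ℝ) ^ a - b) ^ n := by
  have hy : Filter.Tendsto (fun q : ℕ => (q : ℝ) ^ a) Filter.atTop Filter.atTop :=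
    (tendsto_rpow_atTop ha).comp tendsto_natCast_atTop_atTop
  have hlim : Filter.Tendsto (fun q : ℕ => (1 - b / (q : ℝ) ^ a) ^ n) Filter.atTop (nhds 1) := by
    simpa using ((hy.const_div_atTop b).const_sub 1).pow n
  obtain ⟨q₀, h⟩ := Filter.eventually_atTop.1 (((hy.eventually_ge_atTop b).and
    (hy.eventually_gt_atTop 0)).and (hlim.eventually_const_le (sub_lt_self 1 hε)))
  refine ⟨q₀, fun q hq => ?_⟩
  obtain ⟨⟨h1, h2⟩, h3⟩ := h q hq
  refine ⟨h1, (mul_le_mul_of_nonneg_right h3 (by positivity)).trans_eq ?_⟩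
  rw [← mul_pow, sub_mul, one_mul, div_mul_cancel₀ _ h2.ne']

end Numerics

section Main

variable {F : Type} [Field F]

lemma sum_range_multichoose_le_finrank [Fintype F] {k j : ℕ} (hk : 1 ≤ k)
    {I : Ideal (MvPolynomial (Fin (k + j)) F)} (hI : IsHomogeneousIdeal I)
    [hfin : FiniteDimensional F (MvPolynomial (Fin (k + j)) F ⧸ I)] {B : ℝ}
    (hB : ∀ V : Submodule F (Fin (k + j) → F), Module.finrank F V = k →
      B ≤ Module.finrank F (MvPolynomial (Fin (k + j)) F ⧸
        (I + linearSubspaceIdeal F (k + j) V)))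
    {D : ℕ} (hD : D ≤ Fintype.card F) (hDB : ((D + k - 1).choose k : ℝ) ≤ B) :
    ((D + (k + j) - 1).choose (k + j) : ℝ) ≤
      Module.finrank F (MvPolynomial (Fin (k + j)) F ⧸ I) := by
  obtain ⟨E, hE⟩ := exists_hilb_eq_zero hI
  have h1 := le_sum_restrictWeight_mul_hilb hk j I hfin
    (fun d hd => hE d ((le_max_left E D).trans hd)) hB
  have h2 := sum_le_sum_of_antitone_weight (restrictWeight_antitone hk j)
    (restrictWeight_pos (Q := Fintype.card F - 1) hk j) (fun d => Nat.cast_nonneg (hilb I d))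
    (fun d => Nat.cast_le.2 (hilb_le_multichoose I d)) (le_max_right E D) (le_trans ?_ h1)
  · rw [← sum_range_multichoose (by omega)]
    have h3 := sum_hilb_le_finrank hI (Finset.range (max E D))
    rw [← Nat.cast_sum, ← Nat.cast_sum] at h2
    exact_mod_cast h2.trans (Nat.cast_le.2 h3)
  · refine le_trans (Eq.le ?_) hDB
    rw [← sum_range_multichoose hk, Nat.cast_sum]
    refine Finset.sum_congr rfl fun d hd => restrictWeight_mul_multichoose hk ?_ j
    have := Finset.mem_range.1 hd
    omega

/-- Explicit lower bound, for directions that are `y ^ k / k!`-rich with `y` real. -/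
lemma sub_pow_div_factorial_le_finrank [Fintype F] {n k : ℕ} (hk : 1 ≤ k) (hkn : k ≤ n)
    {I : Ideal (MvPolynomial (Fin n) F)} (hI : IsHomogeneousIdeal I)
    (hfin : FiniteDimensional F (MvPolynomial (Fin n) F ⧸ I)) {y : ℝ}
    (hy : k + 1 ≤ y) (hyF : y ≤ Fintype.card F)
    (hB : ∀ V : Submodule F (Fin n → F), Module.finrank F V = k →
      y ^ k / k.factorial ≤ Module.finrank F (MvPolynomial (Fin n) F ⧸
        (I + linearSubspaceIdeal F n V))) :
    (y - (k + 1)) ^ n / n.factorial ≤ Module.finrank F (MvPolynomial (Fin n) F ⧸ I) := by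
  obtain ⟨j, rfl⟩ := Nat.exists_eq_add_of_le hkn
  have hy0 : 0 ≤ y := by linarith [(Nat.cast_nonneg k : (0 : ℝ) ≤ k)]
  have hfl : (⌊y⌋₊ : ℝ) ≤ y := Nat.floor_le hy0
  have hlt : y < ⌊y⌋₊ + 1 := Nat.lt_floor_add_one y
  have hky : k ≤ ⌊y⌋₊ := Nat.le_floor (by linarith)
  obtain ⟨D, hD⟩ := Nat.exists_eq_add_of_le' hky
  have hDy : ((D + k - 1 : ℕ) : ℝ) ≤ y := by
    refine le_trans ?_ hfl
    exact_mod_cast (by omega : D + k - 1 ≤ ⌊y⌋₊)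
  have hDF : D ≤ Fintype.card F := by
    have : ⌊y⌋₊ ≤ Fintype.card F := by exact_mod_cast hfl.trans hyF
    omega
  refine le_trans ?_ ((pow_div_factorial_le_choose (k + j) D).trans
    (sum_range_multichoose_le_finrank hk hI hB hDF ?_))
  · rw [hD] at hlt
    push_cast at hlt
    have : y - (k + 1) ≤ D := by linarith
    gcongr
  · refine (Nat.choose_le_pow_div _ _).trans ?_
    gcongr

lemma one_le_finrank_quotient_of_pos {n k : ℕ} (hkn : k ≤ n) {I : Ideal (MvPolynomial (Fin n) F)}
    [FiniteDimensional F (MvPolynomial (Fin n) F ⧸ I)] {B : ℝ} (hB0 : 0 < B)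
    (hB : ∀ V : Submodule F (Fin n → F), Module.finrank F V = k →
      B ≤ Module.finrank F (MvPolynomial (Fin n) F ⧸ (I + linearSubspaceIdeal F n V))) :
    1 ≤ Module.finrank F (MvPolynomial (Fin n) F ⧸ I) := by
  obtain ⟨V, hV⟩ : ∃ V : Submodule F (Fin n → F), Module.finrank F V = k := by
    obtain ⟨f, hf⟩ := (finrank_le_iff_exists_linearMap (R := F)
      (M := Fin k → F) (M' := Fin n → F)).1 (by simpa)
    exact ⟨LinearMap.range f, by simp [LinearMap.finrank_range_of_inj hf]⟩
  have h := hB0.trans_le (hB V hV)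
  have h' : 0 < Module.finrank F (MvPolynomial (Fin n) F ⧸ (I + linearSubspaceIdeal F n V)) := by
    exact_mod_cast h
  exact h'.trans_le (LinearMap.finrank_le_finrank_of_surjective
    (f := (Ideal.Quotient.factorₐ F (le_sup_left :
      I ≤ I + linearSubspaceIdeal F n V)).toLinearMap)
    (Ideal.Quotient.factor_surjective le_sup_left))

end Main

/-- **Remark 7.2** (precise asymptotic constants): if every `k`-dimensional
direction is `q^c/k!`-rich for the homogeneous 0-dimensional scheme defined by
`I`, then `N ≥ (1−ε)·q^{cn/k}/n!` for all sufficiently large `q`. -/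
theorem furstenberg_asymptotic_constants
    (n k : ℕ) (hn : 1 ≤ n) (hk1 : 1 ≤ k) (hkn : k ≤ n)
    (c : ℝ) (hc0 : 0 ≤ c) (hck : c ≤ (k : ℝ)) (ε : ℝ) (hε : 0 < ε) :
    ∃ q₀ : ℕ, ∀ (F : Type) [Field F] [Fintype F],
      q₀ ≤ Fintype.card F →
      ∀ I : Ideal (MvPolynomial (Fin n) F),
        IsHomogeneousIdeal I →
        FiniteDimensional F (MvPolynomial (Fin n) F ⧸ I) →
        (∀ V : Submodule F (Fin n → F), Module.finrank F V = k →
          (Fintype.card F : ℝ) ^ c / (Nat.factorial k : ℝ) ≤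
            (Module.finrank F (MvPolynomial (Fin n) F ⧸
              (I + linearSubspaceIdeal F n V)) : ℝ)) →
        (1 - ε) * (Fintype.card F : ℝ) ^ (c * n / k) / (Nat.factorial n : ℝ) ≤
          (Module.finrank F (MvPolynomial (Fin n) F ⧸ I) : ℝ) := by
  have hk0 : (0 : ℝ) < k := by exact_mod_cast hk1
  rcases hc0.eq_or_lt with rfl | hc
  · refine ⟨0, fun F _ _ _ I _ hfin hB => ?_⟩
    simp only [Real.rpow_zero, zero_mul, zero_div, mul_one] at hB ⊢
    have h1 := one_le_finrank_quotient_of_pos hkn (by positivity) hB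
    calc (1 - ε) / (n.factorial : ℝ) ≤ 1 / n.factorial := by gcongr; linarith
      _ ≤ 1 := div_le_one_of_le₀ (by exact_mod_cast n.factorial_pos) (by positivity)
      _ ≤ _ := by exact_mod_cast h1
  · obtain ⟨q₀, h⟩ := exists_one_sub_mul_rpow_pow_le (div_pos hc hk0) (k + 1) n hε
    refine ⟨q₀, fun F _ _ hq I hI hfin hB => ?_⟩
    obtain ⟨hy, hpow⟩ := h _ hq
    have hq1 : (1 : ℝ) ≤ Fintype.card F := by exact_mod_cast Fintype.card_pos (α := F)
    have hyk : (Fintype.card F : ℝ) ^ c = ((Fintype.card F : ℝ) ^ (c / k)) ^ k := by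
      rw [← Real.rpow_mul_natCast (by positivity), div_mul_cancel₀ _ hk0.ne']
    have hyn : (Fintype.card F : ℝ) ^ (c * n / k) = ((Fintype.card F : ℝ) ^ (c / k)) ^ n := by
      rw [← Real.rpow_mul_natCast (by positivity), div_mul_eq_mul_div]
    have hyF : (Fintype.card F : ℝ) ^ (c / k) ≤ Fintype.card F :=
      Real.rpow_le_self_of_one_le hq1 ((div_le_one hk0).2 hck)
    rw [hyk] at hB
    rw [hyn]
    exact (div_le_div_of_nonneg_right hpow (by positivity)).trans
      (sub_pow_div_factorial_le_finrank hk1 hkn hI hfin hy hyF hB)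
end

section
/- Let n ≥ 2 and let Λ be a Borel-fixed set of monomials in x₁,…,xₙ. For j ∈ ℕ let Λ_j denote the set of monomials μ in x₂,…,xₙ such that x₁^j·μ ∈ Λ. If |Λ₀| ≥ binom(b, n−1), then |Λ_j| ≥ binom(b−j, n−1) for every j ≥ 0. -/
/-- A Borel-fixed set of monomials in `m+1` variables (identified with exponent
vectors): a finite set closed under divisibility and under Borel moves
`x_j ↦ x_i` for `i < j`. -/
def BorelFixed {n : ℕ} (Λ : Finset (Fin n → ℕ)) : Prop :=
  (∀ lam ∈ Λ, ∀ mu : Fin n → ℕ, (∀ i, mu i ≤ lam i) → mu ∈ Λ) ∧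
  (∀ lam ∈ Λ, ∀ i j : Fin n, i < j → 0 < lam j →
    (lam - Pi.single j 1 + Pi.single i 1) ∈ Λ)

/-- The exponent vectors `μ` of the last `m` variables with `x₁ ^ j * μ ∈ Λ`. -/
noncomputable def borelSlice {m : ℕ} (j : ℕ) (Λ : Finset (Fin (m + 1) → ℕ)) :
    Finset (Fin m → ℕ) :=
  Λ.preimage (fun v => (Fin.cons j v : Fin (m + 1) → ℕ))
    (Fin.cons_right_injective (α := fun _ => ℕ) j).injOn

/-- The exponent vectors `μ` with `x₁ * μ ∈ Λ`. -/
noncomputable def borelShift {m : ℕ} (Λ : Finset (Fin (m + 1) → ℕ)) :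
    Finset (Fin (m + 1) → ℕ) :=
  Λ.preimage (fun v => v + Pi.single 0 1) (add_left_injective _).injOn

theorem mem_borelSlice {m j : ℕ} {Λ : Finset (Fin (m + 1) → ℕ)} {v : Fin m → ℕ} :
    v ∈ borelSlice j Λ ↔ (Fin.cons j v : Fin (m + 1) → ℕ) ∈ Λ := by
  simp [borelSlice]

theorem mem_borelShift {m : ℕ} {Λ : Finset (Fin (m + 1) → ℕ)} {v : Fin (m + 1) → ℕ} :
    v ∈ borelShift Λ ↔ v + Pi.single 0 1 ∈ Λ := by
  simp [borelShift]

theorem BorelFixed.slice {m : ℕ} {Λ : Finset (Fin (m + 1) → ℕ)} (h : BorelFixed Λ)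
    (j : ℕ) : BorelFixed (borelSlice j Λ) := by
  refine ⟨fun lam hl mu hmu => ?_, fun lam hl i k hik hk => ?_⟩
  · rw [mem_borelSlice] at hl ⊢
    exact h.1 _ hl _ (Fin.cases (by simp) (by simpa using hmu))
  · rw [mem_borelSlice] at hl ⊢
    convert h.2 _ hl i.succ k.succ (by simpa using hik) (by simpa using hk) using 1
    funext t
    refine Fin.cases ?_ (fun t => ?_) t
    · simp [(Fin.succ_ne_zero _).symm]
    · simp [Pi.single_apply]

theorem BorelFixed.shift {m : ℕ} {Λ : Finset (Fin (m + 1) → ℕ)} (h : BorelFixed Λ) :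
    BorelFixed (borelShift Λ) := by
  refine ⟨fun lam hl mu hmu => ?_, fun lam hl i k hik hk => ?_⟩
  · rw [mem_borelShift] at hl ⊢
    exact h.1 _ hl _ (fun i => Nat.add_le_add_right (hmu i) _)
  · rw [mem_borelShift] at hl ⊢
    convert h.2 _ hl i k hik (by simp [hk]) using 1
    funext t
    by_cases ht : t = k
    · subst ht
      simp only [Pi.add_apply, Pi.sub_apply, Pi.single_eq_same]
      omega
    · simp only [Pi.add_apply, Pi.sub_apply, Pi.single_eq_of_ne ht]
      omega

theorem borelSlice_borelShift {m : ℕ} (Λ : Finset (Fin (m + 1) → ℕ)) (j : ℕ) :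
    borelSlice j (borelShift Λ) = borelSlice (j + 1) Λ := by
  ext v
  rw [mem_borelSlice, mem_borelShift, mem_borelSlice]
  suffices (Fin.cons j v + Pi.single 0 1 : Fin (m + 1) → ℕ) = Fin.cons (j + 1) v by rw [this]
  funext t
  refine Fin.cases ?_ (fun t => ?_) t <;> simp

theorem card_borelSlice_zero_add_card_borelShift {m : ℕ} (Λ : Finset (Fin (m + 1) → ℕ)) :
    (borelSlice 0 Λ).card + (borelShift Λ).card = Λ.card := by
  rw [← Finset.card_filter_add_card_filter_not (s := Λ) (fun v => v 0 = 0)]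
  congr 1
  · refine Finset.card_bij (fun v _ => Fin.cons 0 v) (fun v hv => ?_)
      (fun v _ w _ hvw => Fin.cons_right_injective (α := fun _ => ℕ) 0 hvw) (fun v hv => ?_)
    · simpa [mem_borelSlice] using hv
    · rw [Finset.mem_filter] at hv
      have hc : (Fin.cons 0 (Fin.tail v) : Fin (m + 1) → ℕ) = v := by
        rw [← hv.2, Fin.cons_self_tail]
      exact ⟨Fin.tail v, by rw [mem_borelSlice, hc]; exact hv.1, hc⟩
  · refine Finset.card_bij (fun v _ => v + Pi.single 0 1) (fun v hv => ?_)
      (fun v _ w _ hvw => add_left_injective _ hvw) (fun v hv => ?_)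
    · simpa [mem_borelShift] using hv
    · rw [Finset.mem_filter] at hv
      have hc : v - Pi.single 0 1 + Pi.single 0 1 = v :=
        tsub_add_cancel_of_le (fun i => Fin.cases
          (by simpa using Nat.one_le_iff_ne_zero.2 hv.2) (fun t => by simp) i)
      exact ⟨v - Pi.single 0 1, by rw [mem_borelShift, hc]; exact hv.1, hc⟩

theorem BorelFixed.borelShift_borelSlice_zero_subset {m : ℕ}
    {Λ : Finset (Fin (m + 2) → ℕ)} (h : BorelFixed Λ) :
    borelShift (borelSlice 0 Λ) ⊆ borelSlice 1 Λ := by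
  intro v hv
  rw [mem_borelShift, mem_borelSlice] at hv
  rw [mem_borelSlice]
  convert h.2 _ hv 0 (Fin.succ 0) (Fin.succ_pos _) (by simp) using 1
  funext t
  refine Fin.cases ?_ (fun t => ?_) t
  · simp
  · simp [Pi.single_apply, -Fin.succ_zero_eq_one, -Fin.succ_zero_eq_one']

/-- If the lower bound passes from the zeroth slice to the first in `m + 2` variables, then it can
be summed over all slices. -/
theorem BorelFixed.choose_le_card {m : ℕ}
    (step : ∀ (b : ℕ) (Λ : Finset (Fin (m + 2) → ℕ)), BorelFixed Λ →
      b.choose (m + 1) ≤ (borelSlice 0 Λ).card →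
      (b - 1).choose (m + 1) ≤ (borelSlice 1 Λ).card) (b : ℕ) :
    ∀ Λ : Finset (Fin (m + 2) → ℕ), BorelFixed Λ →
      b.choose (m + 1) ≤ (borelSlice 0 Λ).card → (b + 1).choose (m + 2) ≤ Λ.card := by
  induction b with
  | zero => intro Λ _ _; simp [Nat.choose_eq_zero_of_lt]
  | succ b ih =>
    intro Λ h h0
    have h1 := ih _ h.shift (by
      rw [borelSlice_borelShift]
      exact step _ Λ h h0)
    rw [← card_borelSlice_zero_add_card_borelShift, Nat.choose_succ_succ]
    exact Nat.add_le_add h0 h1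

theorem BorelFixed.choose_pred_le_card_borelShift {m : ℕ} (b : ℕ)
    (A : Finset (Fin (m + 1) → ℕ)) (h : BorelFixed A) (hA : b.choose (m + 1) ≤ A.card) :
    (b - 1).choose (m + 1) ≤ (borelShift A).card := by
  induction m generalizing b with
  | zero =>
    have hc := card_borelSlice_zero_add_card_borelShift A
    have h1 : (borelSlice 0 A).card ≤ 1 := Finset.card_le_one_of_subsingleton _
    simp only [zero_add, Nat.choose_one_right] at hA ⊢
    omega
  | succ m ih =>
    have step : ∀ (b : ℕ) (Λ : Finset (Fin (m + 2) → ℕ)), BorelFixed Λ →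
        b.choose (m + 1) ≤ (borelSlice 0 Λ).card →
        (b - 1).choose (m + 1) ≤ (borelSlice 1 Λ).card := fun b Λ hΛ h0 =>
      (ih b _ (hΛ.slice 0) h0).trans
        (Finset.card_le_card hΛ.borelShift_borelSlice_zero_subset)
    obtain _ | _ | b := b
    · simp
    · simp
    have hc := card_borelSlice_zero_add_card_borelShift A
    have hp := Nat.choose_succ_succ (b + 1) (m + 1)
    by_cases h0 : (b + 1).choose (m + 1) ≤ (borelSlice 0 A).card
    · refine choose_le_card step b _ h.shift ?_
      rw [borelSlice_borelShift]
      exact step _ _ h h0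
    · simp only [Nat.succ_eq_add_one, Nat.add_sub_cancel] at *
      omega

theorem BorelFixed.choose_sub_le_card_borelSlice {m : ℕ} (j b : ℕ)
    (Λ : Finset (Fin (m + 2) → ℕ)) (h : BorelFixed Λ)
    (h0 : b.choose (m + 1) ≤ (borelSlice 0 Λ).card) :
    (b - j).choose (m + 1) ≤ (borelSlice j Λ).card := by
  induction j generalizing b Λ with
  | zero => exact h0
  | succ j ih =>
    rw [← borelSlice_borelShift, Nat.add_comm j 1, ← Nat.sub_sub]
    refine ih _ _ h.shift ?_
    rw [borelSlice_borelShift]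
    exact (choose_pred_le_card_borelShift b _ (h.slice 0) h0).trans
      (Finset.card_le_card h.borelShift_borelSlice_zero_subset)

theorem natCard_cons_mem {m : ℕ} (j : ℕ) (Λ : Finset (Fin (m + 1) → ℕ)) :
    Nat.card {mu : Fin m → ℕ // Fin.cons j mu ∈ Λ} = (borelSlice j Λ).card := by
  exact Nat.subtype_card _ fun _ => mem_borelSlice

/-- For a Borel-fixed set of monomials `Λ` in `n = m+1 ≥ 2` variables, write
`Λ_j` for the set of monomials `μ` in the last `m` variables with `x₁^j·μ ∈ Λ`.
If `|Λ₀| ≥ binom(b, n−1)`, then `|Λ_j| ≥ binom(b−j, n−1)` for every `j`. -/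
theorem borel_slices_lower_bound (m : ℕ) (hm : 1 ≤ m) (b : ℕ)
    (Λ : Finset (Fin (m + 1) → ℕ)) (hB : BorelFixed Λ)
    (h0 : Nat.choose b m ≤ Nat.card {mu : Fin m → ℕ // Fin.cons 0 mu ∈ Λ}) :
    ∀ j : ℕ, Nat.choose (b - j) m ≤ Nat.card {mu : Fin m → ℕ // Fin.cons j mu ∈ Λ} := by
  obtain ⟨m, rfl⟩ : ∃ k, m = k + 1 := ⟨m - 1, by omega⟩
  intro j
  rw [natCard_cons_mem] at h0 ⊢
  exact hB.choose_sub_le_card_borelSlice j b Λ h0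
end
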